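/- For all n ≥ 1 and k ≥ 1, the total number of colored Lyndon trees on [n] with all colors in [k] equals Σ_{Υ ∈ Nor_n} e_{λ^{Comb}(Υ)}(1, 1, …, 1) with k ones substituted, i.e. Σ_{μ ∈ wcomp_{n−1}, supp(μ) ⊆ [k]} |Lyn_μ| = Σ_{Υ ∈ Nor_n} e_{λ^{Comb}(Υ)}(1^k). (This number is dim Lie_k(n).) -/

import Mathlib

/-! Colored labeled binary trees.  Leaf labels are positive integers; colors are
natural numbers (the paper's color set ℙ = {1,2,…} is identified with ℕ via j ↦ j-1,
i.e. color index `i : ℕ` represents the paper's color `i+1`). -/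

inductive CTree : Type
  | leaf (label : ℕ) : CTree
  | node (color : ℕ) (l r : CTree) : CTree
deriving DecidableEq

namespace CTree

/-- leaf labels from left to right -/
def leavesList : CTree → List ℕ
  | leaf m => [m]
  | node _ l r => leavesList l ++ leavesList r

/-- the valency `v(x)`: smallest leaf label of the subtree -/
def minLeaf : CTree → ℕ
  | leaf m => m
  | node _ l r => min (minLeaf l) (minLeaf r)

/-- a tree is normalized if in every subtree the leftmost leaf carries the
smallest leaf label of the subtree. -/
def Normalized : CTree → Prop
  | leaf _ => True
  | node _ l r => Normalized l ∧ Normalized r ∧ minLeaf l < minLeaf r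

/-- number of internal nodes with color `j` -/
def colorCount : CTree → ℕ → ℕ
  | leaf _, _ => 0
  | node c l r, j => (if c = j then 1 else 0) + colorCount l j + colorCount r j

def isLeafB : CTree → Bool
  | leaf _ => true
  | node _ _ _ => false

def left : CTree → CTree
  | leaf m => leaf m
  | node _ l _ => l

def right : CTree → CTree
  | leaf m => leaf m
  | node _ _ r => r

def rootColor : CTree → ℕ
  | leaf _ => 0
  | node c _ _ => c

/-- the root of `T` is a Lyndon node: either the left child is a leaf
or `v(R(L(x))) > v(R(x))`. (Leaves count as Lyndon.) -/
def RootLyndonB (T : CTree) : Bool :=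
  isLeafB T || isLeafB (left T) || decide (minLeaf (right T) < minLeaf (right (left T)))

/-- colored Lyndon condition: every internal node that is not a Lyndon node
satisfies `color(L(x)) > color(x)` -/
def LynColored : CTree → Prop
  | leaf _ => True
  | node c l r => LynColored l ∧ LynColored r ∧
      (RootLyndonB (node c l r) = true ∨ c < rootColor l)

/-- colored comb condition: every internal node whose right child is internal
satisfies `color(x) > color(R(x))` -/
def CombColored : CTree → Prop
  | leaf _ => True
  | node c l r => CombColored l ∧ CombColored r ∧ (isLeafB r = true ∨ rootColor r < c)

/-- all colors equal to `0`: an (essentially) uncolored tree. -/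
def Mono : CTree → Prop
  | leaf _ => True
  | node c l r => c = 0 ∧ Mono l ∧ Mono r

/-- the tree has leaf label set `[n] = {1,…,n}` (each label once) -/
def OnSet (n : ℕ) (T : CTree) : Prop := T.leavesList.Perm ((List.range n).map (· + 1))

/-- `lynAux T = (b, m)`: `b` is the size of the block of `π^{Lyn}` containing the
root (`0` for a leaf) and `m` is the multiset of sizes of the other blocks. -/
def lynAux : CTree → ℕ × Multiset ℕ
  | leaf _ => (0, 0)
  | node c l r =>
    let bl := (lynAux l).1
    let ml := (lynAux l).2
    let br := (lynAux r).1
    let mr := (lynAux r).2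
    let closedR := mr + (if br = 0 then 0 else {br})
    if RootLyndonB (node c l r) then
      (1, ml + (if bl = 0 then 0 else {bl}) + closedR)
    else (1 + bl, ml + closedR)

/-- the Lyndon type `λ^{Lyn}`: multiset of block sizes of `π^{Lyn}` -/
def lynType (T : CTree) : Multiset ℕ :=
  (if (lynAux T).1 = 0 then (0 : Multiset ℕ) else {(lynAux T).1}) + (lynAux T).2

def combAux : CTree → ℕ × Multiset ℕ
  | leaf _ => (0, 0)
  | node _ l r =>
    let bl := (combAux l).1
    let ml := (combAux l).2
    let br := (combAux r).1
    let mr := (combAux r).2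
    (1 + br, ml + mr + (if bl = 0 then 0 else {bl}))

/-- the comb type `λ^{Comb}`: multiset of block sizes of `π^{Comb}` -/
def combType (T : CTree) : Multiset ℕ :=
  (if (combAux T).1 = 0 then (0 : Multiset ℕ) else {(combAux T).1}) + (combAux T).2

/-- subtrees (= nodes) of a tree -/
def subtreesC : CTree → List CTree
  | leaf m => [leaf m]
  | node c l r => node c l r :: (subtreesC l ++ subtreesC r)

end CTree

/-- normalized uncolored labeled binary trees on `[n]`: the set `Nor_n`. -/
def NorSet (n : ℕ) : Set CTree :=
  {T | T.OnSet n ∧ T.Normalized ∧ T.Mono}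

/-- `Lyn_μ` for a weak composition `μ` (indexed by ℕ; `μ i` is the number of
internal nodes of color `i`). -/
def LynSet (n : ℕ) (μ : ℕ →₀ ℕ) : Set CTree :=
  {T | T.OnSet n ∧ T.Normalized ∧ T.LynColored ∧ ∀ j, T.colorCount j = μ j}

/-- `Comb_μ` -/
def CombSet (n : ℕ) (μ : ℕ →₀ ℕ) : Set CTree :=
  {T | T.OnSet n ∧ T.Normalized ∧ T.CombColored ∧ ∀ j, T.colorCount j = μ j}

/-- `Lyn_μ` for `μ ∈ wcomp` with support in `[k]`, given as `f : Fin k → ℕ`. -/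
def LynSetF (n k : ℕ) (f : Fin k → ℕ) : Set CTree :=
  {T | T.OnSet n ∧ T.Normalized ∧ T.LynColored ∧
    ∀ j : ℕ, T.colorCount j = if h : j < k then f ⟨j, h⟩ else 0}

def CombSetF (n k : ℕ) (f : Fin k → ℕ) : Set CTree :=
  {T | T.OnSet n ∧ T.Normalized ∧ T.CombColored ∧
    ∀ j : ℕ, T.colorCount j = if h : j < k then f ⟨j, h⟩ else 0}

namespace CTree

/-- number of nodes -/
def sz : CTree → ℕ
  | leaf _ => 1
  | node _ l r => sz l + sz r + 1

/-- multiset of leaf labels -/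
def lvs : CTree → Multiset ℕ
  | leaf m => {m}
  | node _ l r => lvs l + lvs r

/-- multiset of colors -/
def cols : CTree → Multiset ℕ
  | leaf _ => 0
  | node c l r => c ::ₘ (cols l + cols r)

/-- reversed comb condition: colors strictly increase along right chains -/
def CombC : CTree → Prop
  | leaf _ => True
  | node c l r => CombC l ∧ CombC r ∧ (isLeafB r = true ∨ c < rootColor r)

/-- leaf, or root color bigger than `d` -/
def TopOK (d : ℕ) (b : CTree) : Prop := isLeafB b = true ∨ d < rootColor b

/-- no color on the right spine lies in `[e, d]` -/
def Gap (d e : ℕ) : CTree → Prop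
  | leaf _ => True
  | node f _ X => (f < e ∨ d < f) ∧ Gap d e X

/-- put `W` at the front of the right spine, and insert the color `e` in the sorted spine colors -/
def push (W : CTree) (e : ℕ) : CTree → CTree
  | leaf m => node e W (leaf m)
  | node f Y X => if f < e then node f W (push Y e X) else node e W (node f Y X)

/-- inverse of `push` -/
def pop (d : ℕ) : CTree → Option (CTree × ℕ × CTree)
  | leaf _ => none
  | node f Y X => if f ≤ d then
      (match pop d X with
        | none => some (Y, f, X)
        | some (W, e, X') => some (Y, e, node f W X'))
      else none

theorem pop_none {d : ℕ} {b : CTree} : pop d b = none ↔ TopOK d b := by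
  cases b with
  | leaf m => simp [pop, TopOK, isLeafB]
  | node f Y X =>
    simp only [pop, TopOK, isLeafB, rootColor]
    by_cases h : f ≤ d
    · simp only [h, if_true]
      cases pop d X <;> simp <;> omega
    · simp [h]; omega

theorem pop_push {d e : ℕ} (he : e ≤ d) : ∀ (b W : CTree), Gap d e b →
    pop d (push W e b) = some (W, e, b) := by
  intro b
  induction b with
  | leaf m => intro W _; simp [push, pop, he]
  | node f Y X ihY ihX =>
    intro W hg
    obtain ⟨h1, h2⟩ := hg
    by_cases hf : f < e
    · have : f ≤ d := by omega
      simp [push, pop, hf, this, ihX Y h2]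
    · have hd : ¬ f ≤ d := by omega
      simp [push, pop, hf, he, hd]

theorem gap_of_topOK {d e : ℕ} : ∀ b : CTree, CombC b → TopOK d b → Gap d e b := by
  intro b
  induction b with
  | leaf m => intros; trivial
  | node f Y X ihY ihX =>
    intro hc ht
    have hf : d < f := by simpa [TopOK, isLeafB, rootColor] using ht
    refine ⟨Or.inr hf, ihX hc.2.1 ?_⟩
    rcases hc.2.2 with h | h
    · exact Or.inl h
    · exact Or.inr (by omega)

theorem pop_some_spec {d : ℕ} : ∀ (b W : CTree) (e : ℕ) (b' : CTree),
    CombC b → pop d b = some (W, e, b') →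
    b = push W e b' ∧ e ≤ d ∧ Gap d e b' ∧ CombC W ∧ CombC b' ∧ rootColor b ≤ e ∧
      (isLeafB b' = true ∨ rootColor b ≤ rootColor b') := by
  intro b
  induction b with
  | leaf m => intro W e b' _ h; simp [pop] at h
  | node f Y X ihY ihX =>
    intro W e b' hc h
    obtain ⟨hY, hX, hr⟩ := hc
    by_cases hf : f ≤ d
    swap
    · simp [pop, hf] at h
    simp only [pop, hf, if_true] at h
    cases hp : pop d X with
    | none =>
      rw [hp] at h
      simp only [Option.some.injEq, Prod.mk.injEq] at h
      obtain ⟨rfl, rfl, rfl⟩ := h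
      have ht := pop_none.1 hp
      refine ⟨?_, hf, gap_of_topOK _ hX ht, hY, hX, le_refl _, ?_⟩
      · cases X with
        | leaf m => rfl
        | node g P Q =>
          have : f < g := by simpa [isLeafB, rootColor] using hr
          simp [push, not_lt.2 this.le]
      · rcases hr with h | h
        · exact Or.inl h
        · exact Or.inr h.le
    | some p =>
      obtain ⟨W2, e2, X'⟩ := p
      rw [hp] at h
      simp only [Option.some.injEq, Prod.mk.injEq] at h
      obtain ⟨rfl, rfl, rfl⟩ := h
      obtain ⟨h1, h2, h3, h4, h5, h6, h7⟩ := ihX _ _ _ hX hp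
      have hfr : f < rootColor X := by
        rcases hr with h | h
        · cases X with
          | leaf m => simp [pop] at hp
          | node g P Q => simp [isLeafB] at h
        · exact h
      have hfe : f < e2 := by omega
      refine ⟨?_, h2, ⟨Or.inl hfe, h3⟩, hY, ⟨h4, h5, ?_⟩, ?_, Or.inr (le_refl _)⟩
      · simp only [push, hfe, if_true]; rw [← h1]
      · rcases h7 with h | h
        · exact Or.inl h
        · exact Or.inr (by omega)
      · exact hfe.le

theorem minLeaf_node {c : ℕ} {l r : CTree} (h : minLeaf l < minLeaf r) :
    minLeaf (node c l r) = minLeaf l := by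
  simp [minLeaf, h.le]

theorem push_norm {e : ℕ} : ∀ (b W : CTree), Normalized W → Normalized b →
    minLeaf W < minLeaf b → Normalized (push W e b) ∧ minLeaf (push W e b) = minLeaf W := by
  intro b
  induction b with
  | leaf m => intro W hW hb h; exact ⟨⟨hW, hb, h⟩, minLeaf_node h⟩
  | node f Y X ihY ihX =>
    intro W hW hb h
    by_cases hf : f < e
    · simp only [push, hf, if_true]
      obtain ⟨h1, h2⟩ := ihX Y hb.1 hb.2.1 hb.2.2
      rw [minLeaf_node hb.2.2] at h
      have h3 : minLeaf W < minLeaf (push Y e X) := by omega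
      exact ⟨⟨hW, h1, h3⟩, minLeaf_node h3⟩
    · simp only [push, hf, if_false]
      exact ⟨⟨hW, hb, h⟩, minLeaf_node h⟩

theorem pop_norm {d : ℕ} : ∀ (b W : CTree) (e : ℕ) (b' : CTree), Normalized b →
    pop d b = some (W, e, b') →
    Normalized W ∧ Normalized b' ∧ minLeaf W < minLeaf b' ∧ minLeaf W = minLeaf b := by
  intro b
  induction b with
  | leaf m => intro W e b' _ h; simp [pop] at h
  | node f Y X ihY ihX =>
    intro W e b' hc h
    obtain ⟨hY, hX, hr⟩ := hc
    by_cases hf : f ≤ d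
    swap
    · simp [pop, hf] at h
    simp only [pop, hf, if_true] at h
    cases hp : pop d X with
    | none =>
      rw [hp] at h
      simp only [Option.some.injEq, Prod.mk.injEq] at h
      obtain ⟨rfl, rfl, rfl⟩ := h
      exact ⟨hY, hX, hr, (minLeaf_node hr).symm⟩
    | some p =>
      obtain ⟨W2, e2, X'⟩ := p
      rw [hp] at h
      simp only [Option.some.injEq, Prod.mk.injEq] at h
      obtain ⟨rfl, rfl, rfl⟩ := h
      obtain ⟨h1, h2, h3, h4⟩ := ihX _ _ _ hX hp
      refine ⟨hY, ⟨h1, h2, h3⟩, ?_, (minLeaf_node hr).symm⟩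
      rw [minLeaf_node h3]; omega

theorem push_comb {d e : ℕ} (he : e ≤ d) : ∀ (b W : CTree), CombC W → CombC b → Gap d e b →
    CombC (push W e b) ∧ isLeafB (push W e b) = false ∧
      (∀ f, f < e → TopOK f b → f < rootColor (push W e b)) := by
  intro b
  induction b with
  | leaf m =>
    intro W hW hb h
    exact ⟨⟨hW, hb, Or.inl rfl⟩, rfl, fun f hf _ => hf⟩
  | node f Y X ihY ihX =>
    intro W hW hb h
    by_cases hf : f < e
    · simp only [push, hf, if_true]
      obtain ⟨h1, h2, h3⟩ := ihX Y hb.1 hb.2.1 h.2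
      refine ⟨⟨hW, h1, Or.inr (h3 f hf hb.2.2)⟩, rfl, ?_⟩
      intro g _ hg
      simpa [TopOK, isLeafB, rootColor] using hg
    · simp only [push, hf, if_false]
      have h1 := h.1
      refine ⟨⟨hW, hb, Or.inr ?_⟩, rfl, fun g hg _ => hg⟩
      simp only [rootColor]; omega

theorem push_ms (e : ℕ) : ∀ (b W : CTree), lvs (push W e b) = lvs W + lvs b ∧
    cols (push W e b) = e ::ₘ (cols W + cols b) ∧ sz (push W e b) = sz W + sz b + 1 := by
  intro b
  induction b with
  | leaf m => intro W; simp [push, lvs, cols, sz]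
  | node f Y X ihY ihX =>
    intro W
    by_cases hf : f < e
    · obtain ⟨h1, h2, h3⟩ := ihX Y
      simp only [push, hf, if_true, lvs, cols, sz, h1, h2, h3, true_and, and_true]
      simp only [← Multiset.singleton_add]; abel
    · simp [push, hf, lvs, cols, sz]

theorem pop_ms {d : ℕ} : ∀ (b W : CTree) (e : ℕ) (b' : CTree), pop d b = some (W, e, b') →
    lvs b = lvs W + lvs b' ∧ cols b = e ::ₘ (cols W + cols b') ∧ sz b = sz W + sz b' + 1 := by
  intro b
  induction b with
  | leaf m => intro W e b' h; simp [pop] at h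
  | node f Y X ihY ihX =>
    intro W e b' h
    by_cases hf : f ≤ d
    swap
    · simp [pop, hf] at h
    simp only [pop, hf, if_true] at h
    cases hp : pop d X with
    | none =>
      rw [hp] at h
      simp only [Option.some.injEq, Prod.mk.injEq] at h
      obtain ⟨rfl, rfl, rfl⟩ := h
      exact ⟨rfl, rfl, rfl⟩
    | some p =>
      obtain ⟨W2, e2, X'⟩ := p
      rw [hp] at h
      simp only [Option.some.injEq, Prod.mk.injEq] at h
      obtain ⟨rfl, rfl, rfl⟩ := h
      obtain ⟨h1, h2, h3⟩ := ihX _ _ _ hp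
      simp only [lvs, cols, sz, h1, h2, h3, true_and, and_true]
      simp only [← Multiset.singleton_add]; abel

theorem sz_pos (b : CTree) : 0 < sz b := by cases b <;> simp [sz]

/-- attach a comb `b` to the comb `a` by color `d`, straightening -/
def gam (a : CTree) (d : ℕ) (b : CTree) : CTree :=
  match h : pop d b with
  | none => node d a b
  | some (W, e, b') => gam (gam a e W) d b'
termination_by sz b
decreasing_by
  all_goals
    have := (pop_ms _ _ _ _ h).2.2
    omega

theorem gam_none {a b : CTree} {d : ℕ} (h : pop d b = none) : gam a d b = node d a b := by
  rw [gam]; split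
  · rfl
  · simp_all

theorem gam_some {a b W b' : CTree} {d e : ℕ} (h : pop d b = some (W, e, b')) :
    gam a d b = gam (gam a e W) d b' := by
  rw [gam]; split
  · simp_all
  · simp_all

/-- from Lyndon trees to combs -/
def Th : CTree → CTree
  | leaf m => leaf m
  | node d A B => gam (Th A) d (Th B)

theorem gam_spec : ∀ (n : ℕ) (b : CTree), sz b ≤ n → ∀ (a : CTree) (d : ℕ),
    Normalized a → CombC a → Normalized b → CombC b → minLeaf a < minLeaf b →
    Normalized (gam a d b) ∧ CombC (gam a d b) ∧ minLeaf (gam a d b) = minLeaf a := by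
  intro n
  induction n with
  | zero => intro b hb; have := sz_pos b; omega
  | succ n ih =>
    intro b hb a d ha1 ha2 hb1 hb2 hv
    cases hp : pop d b with
    | none =>
      rw [gam_none hp]
      exact ⟨⟨ha1, hb1, hv⟩, ⟨ha2, hb2, pop_none.1 hp⟩, minLeaf_node hv⟩
    | some p =>
      obtain ⟨W, e, b'⟩ := p
      rw [gam_some hp]
      obtain ⟨_, _, hs⟩ := pop_ms _ _ _ _ hp
      have := sz_pos W
      have := sz_pos b'
      obtain ⟨n1, n2, n3, n4⟩ := pop_norm _ _ _ _ hb1 hp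
      obtain ⟨c1, c2, c3, c4, c5, c6, c7⟩ := pop_some_spec _ _ _ _ hb2 hp
      obtain ⟨g1, g2, g3⟩ := ih W (by omega) a e ha1 ha2 n1 c4 (by omega)
      obtain ⟨k1, k2, k3⟩ := ih b' (by omega) (gam a e W) d g1 g2 n2 c5 (by omega)
      exact ⟨k1, k2, by omega⟩

theorem gam_ms : ∀ (n : ℕ) (b : CTree), sz b ≤ n → ∀ (a : CTree) (d : ℕ),
    lvs (gam a d b) = lvs a + lvs b ∧ cols (gam a d b) = d ::ₘ (cols a + cols b) ∧
    sz (gam a d b) = sz a + sz b + 1 ∧ ∃ u V, gam a d b = node d u V ∧ TopOK d V := by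
  intro n
  induction n with
  | zero => intro b hb; have := sz_pos b; omega
  | succ n ih =>
    intro b hb a d
    cases hp : pop d b with
    | none =>
      rw [gam_none hp]
      exact ⟨rfl, rfl, rfl, a, b, rfl, pop_none.1 hp⟩
    | some p =>
      obtain ⟨W, e, b'⟩ := p
      rw [gam_some hp]
      obtain ⟨h1, h2, hs⟩ := pop_ms _ _ _ _ hp
      have := sz_pos W
      have := sz_pos b'
      obtain ⟨g1, g2, g3, _⟩ := ih W (by omega) a e
      obtain ⟨k1, k2, k3, k4⟩ := ih b' (by omega) (gam a e W) d
      refine ⟨by rw [k1, g1, h1]; abel, ?_, by omega, k4⟩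
      rw [k2, g2, h2]
      simp only [← Multiset.singleton_add]; abel

theorem Th_spec : ∀ T : CTree, Normalized T →
    Normalized (Th T) ∧ CombC (Th T) ∧ minLeaf (Th T) = minLeaf T := by
  intro T
  induction T with
  | leaf m => intro _; exact ⟨trivial, trivial, rfl⟩
  | node d A B ihA ihB =>
    intro h
    obtain ⟨a1, a2, a3⟩ := ihA h.1
    obtain ⟨b1, b2, b3⟩ := ihB h.2.1
    have hv := h.2.2
    obtain ⟨g1, g2, g3⟩ := gam_spec _ (Th B) (le_refl _) (Th A) d a1 a2 b1 b2 (by omega)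
    exact ⟨g1, g2, by rw [minLeaf_node hv]; exact g3.trans a3⟩

theorem Th_ms : ∀ T : CTree, lvs (Th T) = lvs T ∧ cols (Th T) = cols T ∧ sz (Th T) = sz T := by
  intro T
  induction T with
  | leaf m => exact ⟨rfl, rfl, rfl⟩
  | node d A B ihA ihB =>
    obtain ⟨g1, g2, g3, _⟩ := gam_ms _ (Th B) (le_refl _) (Th A) d
    simp only [Th, g1, g2, g3, lvs, cols, sz, ihA, ihB, and_self]

theorem minLeaf_mem (T : CTree) : minLeaf T ∈ lvs T := by
  induction T with
  | leaf m => simp [minLeaf, lvs]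
  | node c l r ihl ihr =>
    simp only [minLeaf, lvs, Multiset.mem_add]
    rcases min_choice (minLeaf l) (minLeaf r) with h | h <;> rw [h]
    · exact Or.inl ihl
    · exact Or.inr ihr

/-- the pair `(U, b)` is not bad for color `d` -/
def NB (U : CTree) (d : ℕ) (b : CTree) : Prop :=
  isLeafB U = true ∨ minLeaf b < minLeaf (right U) ∨ d < rootColor U

/-- states of the straightening procedure -/
structure St (U : CTree) (d : ℕ) (b : CTree) : Prop where
  nU : Normalized U
  lU : LynColored U
  nb : Normalized b
  cb : CombC b
  lt : minLeaf U < minLeaf b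
  nd : (lvs U + lvs b).Nodup
  inv : NB U d b ∨ Gap d (rootColor U) b

/-- run the pushes as long as possible -/
def prun (d : ℕ) : CTree → CTree → CTree × CTree
  | leaf m, b => (leaf m, b)
  | node e A W, b =>
    if e ≤ d ∧ minLeaf W < minLeaf b then prun d A (push (Th W) e b) else (node e A W, b)

theorem lyn_node {d : ℕ} {A B : CTree} :
    LynColored (node d A B) ↔ LynColored A ∧ LynColored B ∧ NB A d B := by
  have h1 : isLeafB (node d A B) = false := rfl
  have h2 : left (node d A B) = A := rfl
  have h3 : right (node d A B) = B := rfl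
  simp only [LynColored, NB, RootLyndonB, Bool.or_eq_true, decide_eq_true_eq, h1, h2, h3, or_assoc,
    Bool.false_eq_true, false_or]

theorem NB_congr {A b b' : CTree} {d : ℕ} (h : minLeaf b = minLeaf b') :
    NB A d b ↔ NB A d b' := by
  unfold NB; rw [h]

/-- one push keeps states -/
theorem St.step {d e : ℕ} {A W b : CTree} (h : St (node e A W) d b) (he : e ≤ d)
    (hw : minLeaf W < minLeaf b) : Gap d e b ∧ St A d (push (Th W) e b) := by
  have hg : Gap d e b := by
    rcases h.inv with h1 | h1
    · simp only [NB, isLeafB, right, rootColor] at h1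
      exfalso
      rcases h1 with h1 | h1 | h1
      · cases h1
      · omega
      · omega
    · exact h1
  refine ⟨hg, ?_⟩
  obtain ⟨t1, t2, t3⟩ := Th_spec W h.nU.2.1
  obtain ⟨p1, p2⟩ := push_norm (e := e) b (Th W) t1 h.nb (by omega)
  obtain ⟨q1, q2, q3⟩ := push_comb he b (Th W) t2 h.cb hg
  obtain ⟨r1, r2, r3⟩ := push_ms e b (Th W)
  have hl := lyn_node.1 h.lU
  have hAW := h.nU.2.2
  refine ⟨h.nU.1, hl.1, p1, q1, by omega, ?_, ?_⟩
  · have := h.nd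
    rw [r1, (Th_ms W).1]
    simpa [lvs, add_assoc] using this
  · rcases hl.2.2 with h1 | h1 | h1
    · exact Or.inl (Or.inl h1)
    · exact Or.inl (Or.inr (Or.inl (by omega)))
    · right
      have key : ∀ (b W : CTree) (g : ℕ), e < g → Gap d e b → Gap d g (push W e b) := by
        intro b
        induction b with
        | leaf m => intro W g hg _; exact ⟨Or.inl hg, trivial⟩
        | node f Y X ihY ihX =>
          intro W g hg hb
          have hb1 := hb.1
          by_cases hf : f < e
          · simp only [push, hf, if_true]
            exact ⟨Or.inl (by omega), ihX Y g hg hb.2⟩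
          · simp only [push, hf, if_false]
            have mono : ∀ X : CTree, Gap d e X → Gap d g X := by
              intro X
              induction X with
              | leaf m => intros; trivial
              | node f Y X _ ihX =>
                intro h
                have h1 := h.1
                exact ⟨by omega, ihX h.2⟩
            exact ⟨Or.inl hg, mono _ hb⟩
      exact key _ _ _ h1 hg

theorem prun_spec (d : ℕ) : ∀ (U b : CTree), St U d b →
    St (prun d U b).1 d (prun d U b).2 ∧ NB (prun d U b).1 d (prun d U b).2 ∧
    gam (Th (prun d U b).1) d (prun d U b).2 = gam (Th U) d b ∧
    lvs (prun d U b).1 + lvs (prun d U b).2 = lvs U + lvs b ∧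
    sz (prun d U b).1 + sz (prun d U b).2 = sz U + sz b := by
  intro U
  induction U with
  | leaf m => intro b h; exact ⟨h, Or.inl rfl, rfl, rfl, rfl⟩
  | node e A W ihA ihW =>
    intro b h
    by_cases hc : e ≤ d ∧ minLeaf W < minLeaf b
    · simp only [prun, hc, and_self, if_true]
      obtain ⟨hg, hs⟩ := h.step hc.1 hc.2
      obtain ⟨i1, i2, i3, i4, i5⟩ := ihA _ hs
      obtain ⟨r1, r2, r3⟩ := push_ms e b (Th W)
      refine ⟨i1, i2, ?_, ?_, ?_⟩
      · rw [i3, gam_some (pop_push hc.1 _ _ hg)]; rfl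
      · rw [i4, r1, (Th_ms W).1, lvs]; abel
      · rw [i5, r3, (Th_ms W).2.2, sz]; ring
    · simp only [prun, hc, if_false]
      refine ⟨h, ?_, trivial, trivial, trivial⟩
      have hne : minLeaf W ≠ minLeaf b := by
        intro heq
        have hnd := (Multiset.nodup_add.1 h.nd).2.2
        refine Multiset.disjoint_left.1 hnd ?_ (minLeaf_mem b)
        rw [← heq]
        simp only [lvs, Multiset.mem_add]
        exact Or.inr (minLeaf_mem W)
      simp only [NB, isLeafB, right, rootColor]
      omega

theorem prun_of_NB {d : ℕ} {U b : CTree} (h : NB U d b) : prun d U b = (U, b) := by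
  cases U with
  | leaf m => rfl
  | node e A W =>
    simp only [NB, isLeafB, right, rootColor] at h
    have : ¬ (e ≤ d ∧ minLeaf W < minLeaf b) := by
      rcases h with h | h | h
      · cases h
      · omega
      · omega
    simp [prun, this]

/-- surjectivity -/
theorem Th_surj : ∀ (n : ℕ) (C : CTree), sz C ≤ n → Normalized C → CombC C → (lvs C).Nodup →
    ∃ T, Normalized T ∧ LynColored T ∧ Th T = C := by
  intro n
  induction n with
  | zero => intro b hb; have := sz_pos b; omega
  | succ n ih =>
    intro C hC h1 h2 h3
    cases C with
    | leaf m => exact ⟨leaf m, trivial, trivial, rfl⟩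
    | node d u V =>
      simp only [sz] at hC
      have := sz_pos u
      have := sz_pos V
      have hnd := Multiset.nodup_add.1 h3
      obtain ⟨U, u1, u2, u3⟩ := ih u (by omega) h1.1 h2.1 hnd.1
      obtain ⟨-, -, tv⟩ := Th_spec U u1
      obtain ⟨tm1, -, tm3⟩ := Th_ms U
      rw [u3] at tv tm1 tm3
      have hv := h1.2.2
      have hst : St U d V := by
        refine ⟨u1, u2, h1.2.1, h2.2.1, by omega, ?_, ?_⟩
        · rw [← tm1]; exact h3
        · right; exact gap_of_topOK _ h2.2.1 h2.2.2
      obtain ⟨s1, s2, s3, s4, s5⟩ := prun_spec d U V hst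
      set A := (prun d U V).1
      set b := (prun d U V).2
      have := sz_pos A
      obtain ⟨B, b1, b2, b3⟩ := ih b (by omega) s1.nb s1.cb (Multiset.nodup_add.1 s1.nd).2.1
      obtain ⟨-, -, bv⟩ := Th_spec B b1
      rw [b3] at bv
      have := s1.lt
      refine ⟨node d A B, ⟨s1.nU, b1, by omega⟩, lyn_node.2 ⟨s1.lU, b2, (NB_congr bv).1 s2⟩, ?_⟩
      simp only [Th, b3]
      rw [s3, gam_none (pop_none.2 h2.2.2), u3]

/-- pop back to the normal form -/
theorem St.unrun {d : ℕ} : ∀ (n : ℕ) (b : CTree), sz b ≤ n → ∀ A : CTree, St A d b →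
    ∃ U V, Normalized U ∧ LynColored U ∧ (lvs U).Nodup ∧ gam (Th A) d b = node d (Th U) V ∧
      prun d U V = prun d A b ∧ sz U + sz V = sz A + sz b := by
  intro n
  induction n with
  | zero => intro b hb; have := sz_pos b; omega
  | succ n ih =>
    intro b hb A h
    cases hp : pop d b with
    | none =>
      exact ⟨A, b, h.nU, h.lU, (Multiset.nodup_add.1 h.nd).1, gam_none hp, rfl, rfl⟩
    | some p =>
      obtain ⟨w, e, b'⟩ := p
      obtain ⟨m1, m2, m3⟩ := pop_ms _ _ _ _ hp
      have := sz_pos w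
      have := sz_pos b'
      obtain ⟨n1, n2, n3, n4⟩ := pop_norm _ _ _ _ h.nb hp
      obtain ⟨c1, c2, c3, c4, c5, c6, c7⟩ := pop_some_spec _ _ _ _ h.cb hp
      have hnd := h.nd
      rw [m1] at hnd
      have hndw : (lvs w).Nodup :=
        (Multiset.nodup_add.1 (Multiset.nodup_add.1 hnd).2.1).1
      obtain ⟨W, w1, w2, w3⟩ := Th_surj _ w (le_refl _) n1 c4 hndw
      obtain ⟨-, -, wv⟩ := Th_spec W w1
      obtain ⟨wm1, -, wm3⟩ := Th_ms W
      rw [w3] at wv wm1 wm3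
      have hlt := h.lt
      have hgl : ∀ (b' w : CTree) (g : ℕ), Gap d g (push w e b') → e < g ∨ d < e := by
        intro b'
        induction b' with
        | leaf m => intro w g hg; exact hg.1
        | node f Y X _ ihX =>
          intro w g hg
          by_cases hf : f < e
          · simp only [push, hf, if_true] at hg
            exact ihX Y g hg.2
          · simp only [push, hf, if_false] at hg
            exact hg.1
      have hNB : NB A e W := by
        rcases h.inv with (h1 | h1 | h1) | h1
        · exact Or.inl h1
        · exact Or.inr (Or.inl (by omega))
        · exact Or.inr (Or.inr (by omega))
        · rw [c1] at h1
          have := hgl _ _ _ h1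
          exact Or.inr (Or.inr (by omega))
      have hst : St (node e A W) d b' := by
        refine ⟨⟨h.nU, w1, by omega⟩, lyn_node.2 ⟨h.lU, w2, hNB⟩, n2, c5, ?_, ?_, Or.inr c3⟩
        · rw [minLeaf_node (by omega)]; omega
        · simp only [lvs]; rw [← wm1]; rwa [add_assoc]
      obtain ⟨U, V, u1, u2, u3, u4, u5, u6⟩ := ih b' (by omega) _ hst
      refine ⟨U, V, u1, u2, u3, ?_, ?_, ?_⟩
      · rw [gam_some hp, ← u4, Th, w3]
      · rw [u5, prun, if_pos ⟨c2, by omega⟩, w3, ← c1]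
      · rw [u6, sz]; omega

theorem Th_inj : ∀ (n : ℕ) (T T' : CTree), sz T ≤ n → Normalized T → LynColored T →
    (lvs T).Nodup → Normalized T' → LynColored T' → (lvs T').Nodup → Th T = Th T' → T = T' := by
  intro n
  induction n with
  | zero => intro b _ hb; have := sz_pos b; omega
  | succ n ih =>
    intro T T' hs hn hl hd hn' hl' hd' heq
    have hsz : sz T = sz T' := by rw [← (Th_ms T).2.2, ← (Th_ms T').2.2, heq]
    cases T with
    | leaf m =>
      cases T' with
      | leaf m' => exact heq
      | node d' A' B' =>
        have := sz_pos A'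
        have := sz_pos B'
        simp only [sz] at hsz; omega
    | node d A B =>
      cases T' with
      | leaf m' =>
        have := sz_pos A
        have := sz_pos B
        simp only [sz] at hsz; omega
      | node d' A' B' =>
        have mk : ∀ (d : ℕ) (A B : CTree), Normalized (node d A B) → LynColored (node d A B) →
            (lvs (node d A B)).Nodup → St A d (Th B) ∧ NB A d (Th B) := by
          intro d A B hn hl hd
          obtain ⟨t1, t2, t3⟩ := Th_spec B hn.2.1
          have hl := lyn_node.1 hl
          have hNB := (NB_congr t3.symm).1 hl.2.2
          have := hn.2.2
          refine ⟨⟨hn.1, hl.1, t1, t2, by omega, ?_, Or.inl hNB⟩, hNB⟩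
          rw [(Th_ms B).1]; exact hd
        obtain ⟨s1, s2⟩ := mk d A B hn hl hd
        obtain ⟨s1', s2'⟩ := mk d' A' B' hn' hl' hd'
        obtain ⟨U, V, u1, u2, u3, u4, u5, u6⟩ := St.unrun _ _ (le_refl _) _ s1
        obtain ⟨U', V', u1', u2', u3', u4', u5', u6'⟩ := St.unrun _ _ (le_refl _) _ s1'
        simp only [Th] at heq
        rw [u4, u4'] at heq
        simp only [node.injEq] at heq
        obtain ⟨rfl, hU, rfl⟩ := heq
        simp only [sz] at hs hsz
        have e1 := (Th_ms B).2.2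
        have := sz_pos V
        have := sz_pos A
        have := sz_pos B
        have hUU := ih U U' (by omega) u1 u2 u3 u1' u2' u3' hU
        subst hUU
        rw [prun_of_NB s2] at u5
        rw [prun_of_NB s2', u5] at u5'
        simp only [Prod.mk.injEq] at u5'
        obtain ⟨rfl, hB⟩ := u5'
        have hdB := (Multiset.nodup_add.1 hd).2.1
        have hdB' := (Multiset.nodup_add.1 hd').2.1
        have := ih B B' (by omega) hn.2.1 (lyn_node.1 hl).2.1 hdB hn'.2.1
          (lyn_node.1 hl').2.1 hdB' hB
        rw [this]

end CTree

namespace CTree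

theorem lvs_eq (T : CTree) : lvs T = (T.leavesList : Multiset ℕ) := by
  induction T with
  | leaf m => rfl
  | node c l r ihl ihr => simp [lvs, leavesList, ihl, ihr]

theorem onSet_iff {n : ℕ} {T : CTree} :
    OnSet n T ↔ lvs T = (((List.range n).map (· + 1) : List ℕ) : Multiset ℕ) := by
  rw [lvs_eq, Multiset.coe_eq_coe, OnSet]

theorem onSet_nodup {n : ℕ} {T : CTree} (h : OnSet n T) : (lvs T).Nodup := by
  rw [onSet_iff.1 h, Multiset.coe_nodup]
  exact (List.nodup_range).map (fun a b h => by simpa using h)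

theorem colorCount_eq (T : CTree) (j : ℕ) : colorCount T j = (cols T).count j := by
  induction T with
  | leaf m => simp [colorCount, cols]
  | node c l r ihl ihr =>
    simp only [colorCount, cols, ihl, ihr, Multiset.count_cons, Multiset.count_add]
    by_cases h : c = j
    · simp [h]; ring
    · simp [h, Ne.symm h]

theorem card_cols (T : CTree) : (cols T).card + 1 = (lvs T).card := by
  induction T with
  | leaf m => simp [cols, lvs]
  | node c l r ihl ihr => simp only [cols, lvs, Multiset.card_cons, Multiset.card_add]; omega

/-- finiteness of trees with bounded data -/
theorem finite_trees (N k : ℕ) : ∀ h : ℕ,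
    {T : CTree | sz T ≤ h ∧ (∀ x ∈ lvs T, x ≤ N) ∧ ∀ c ∈ cols T, c < k}.Finite := by
  intro h
  induction h with
  | zero =>
    refine Set.Finite.subset Set.finite_empty ?_
    rintro T ⟨hT, -⟩
    have := sz_pos T
    omega
  | succ h ih =>
    refine Set.Finite.subset (((Set.finite_Iic N).image leaf).union
      (((Set.finite_Iio k).prod (ih.prod ih)).image
        (fun p : ℕ × CTree × CTree => node p.1 p.2.1 p.2.2))) ?_
    rintro T ⟨h1, h2, h3⟩
    cases T with
    | leaf m => left; exact ⟨m, h2 m (by simp [lvs]), rfl⟩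
    | node c l r =>
      right
      simp only [sz] at h1
      simp only [lvs, Multiset.mem_add] at h2
      simp only [cols, Multiset.mem_cons, Multiset.mem_add] at h3
      exact ⟨(c, l, r), ⟨h3 c (Or.inl rfl),
        ⟨by dsimp only; omega, fun x hx => h2 x (Or.inl hx), fun x hx => h3 x (Or.inr (Or.inl hx))⟩,
        ⟨by dsimp only; omega, fun x hx => h2 x (Or.inr hx), fun x hx => h3 x (Or.inr (Or.inr hx))⟩⟩, rfl⟩

theorem sz_lvs (T : CTree) : sz T + 1 = 2 * (lvs T).card := by
  induction T with
  | leaf m => simp [sz, lvs]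
  | node c l r ihl ihr => simp only [sz, lvs, Multiset.card_add]; omega

theorem finite_onSet (n k : ℕ) : {T : CTree | OnSet n T ∧ ∀ c ∈ cols T, c < k}.Finite := by
  refine Set.Finite.subset (finite_trees n k (2 * n)) ?_
  rintro T ⟨h1, h2⟩
  rw [onSet_iff] at h1
  refine ⟨?_, ?_, h2⟩
  · have := sz_lvs T
    rw [h1] at this
    simp at this
    omega
  · intro x hx
    rw [h1] at hx
    simp at hx
    obtain ⟨a, ha, rfl⟩ := hx
    omega

/-- forget colors -/
def strip : CTree → CTree
  | leaf m => leaf m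
  | node _ l r => node 0 (strip l) (strip r)

theorem strip_spec (T : CTree) : lvs (strip T) = lvs T ∧ minLeaf (strip T) = minLeaf T ∧
    (Normalized (strip T) ↔ Normalized T) ∧ Mono (strip T) := by
  induction T with
  | leaf m => exact ⟨rfl, rfl, Iff.rfl, trivial⟩
  | node c l r ihl ihr =>
    obtain ⟨a1, a2, a3, a4⟩ := ihl
    obtain ⟨b1, b2, b3, b4⟩ := ihr
    refine ⟨by simp [strip, lvs, a1, b1], by simp [strip, minLeaf, a2, b2],
      by simp [strip, Normalized, a2, b2, a3, b3], rfl, a4, b4⟩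

theorem strip_mono {T : CTree} (h : Mono T) : strip T = T := by
  induction T with
  | leaf m => rfl
  | node c l r ihl ihr =>
    obtain ⟨rfl, h1, h2⟩ := h
    simp [strip, ihl h1, ihr h2]

theorem mono_cols {T : CTree} (h : Mono T) : ∀ c ∈ cols T, c < 1 := by
  induction T with
  | leaf m => simp [cols]
  | node c l r ihl ihr =>
    obtain ⟨rfl, h1, h2⟩ := h
    intro x hx
    simp only [cols, Multiset.mem_cons, Multiset.mem_add] at hx
    rcases hx with rfl | hx | hx
    · omega
    · exact ihl h1 x hx
    · exact ihr h2 x hx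

/-- the colorings of a tree satisfying the comb condition, colors below `k`, root color `≥ d` -/
def colorings (k : ℕ) : CTree → ℕ → Finset CTree
  | leaf m, _ => {leaf m}
  | node _ l r, d => (Finset.Ico d k).biUnion fun c =>
      (colorings k l 0 ×ˢ colorings k r (c + 1)).image fun p => node c p.1 p.2

theorem mem_colorings (k : ℕ) : ∀ (T S : CTree) (d : ℕ), S ∈ colorings k T d ↔
    strip S = strip T ∧ CombC S ∧ (∀ c ∈ cols S, c < k) ∧ (isLeafB S = true ∨ d ≤ rootColor S) := by
  intro T
  induction T with
  | leaf m =>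
    intro S d
    cases S with
    | leaf m' => simp [colorings, strip, CombC, cols, isLeafB]
    | node c l r => simp [colorings, strip]
  | node c0 l r ihl ihr =>
    intro S d
    cases S with
    | leaf m' => simp [colorings, strip]
    | node c l' r' =>
      simp only [colorings, Finset.mem_biUnion, Finset.mem_image, Finset.mem_product, Prod.exists,
        ihl, ihr, node.injEq, Finset.mem_Ico, strip, CombC, cols, isLeafB, rootColor,
        Multiset.mem_cons, Multiset.mem_add]
      constructor
      · rintro ⟨c, hc, a, b, ⟨⟨a1, a2, a3, a4⟩, ⟨b1, b2, b3, b4⟩⟩, rfl, rfl, rfl⟩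
        refine ⟨⟨trivial, a1, b1⟩, ⟨a2, b2, b4⟩, ?_, Or.inr hc.1⟩
        rintro x (rfl | hx | hx)
        · exact hc.2
        · exact a3 x hx
        · exact b3 x hx
      · rintro ⟨⟨-, a1, b1⟩, ⟨a2, b2, b4⟩, h, hd⟩
        refine ⟨c, ⟨by simpa using hd, h c (Or.inl rfl)⟩, l', r',
          ⟨⟨a1, a2, fun x hx => h x (Or.inr (Or.inl hx)), Or.inr (Nat.zero_le _)⟩,
          ⟨b1, b2, fun x hx => h x (Or.inr (Or.inr hx)), b4⟩⟩, rfl, rfl, rfl⟩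

theorem hockey (k b : ℕ) : ∀ j d : ℕ, d + j = k →
    ∑ c ∈ Finset.Ico d k, (k - (c + 1)).choose b = (k - d).choose (b + 1) := by
  intro j
  induction j with
  | zero => intro d h; have : d = k := by omega
            subst this; simp
  | succ j ih =>
    intro d h
    rw [Finset.sum_eq_sum_Ico_succ_bot (by omega), ih (d + 1) (by omega)]
    have : k - d = (k - (d + 1)) + 1 := by omega
    rw [this, Nat.choose_succ_succ]

theorem card_colorings (k : ℕ) : ∀ (T : CTree) (d : ℕ), d ≤ k → (colorings k T d).card =
    (k - d).choose (combAux T).1 * ((combAux T).2.map (Nat.choose k)).prod := by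
  intro T
  induction T with
  | leaf m => intro d _; simp [colorings, combAux]
  | node c0 l r ihl ihr =>
    intro d hd
    have h1 : (colorings k (node c0 l r) d).card = ∑ c ∈ Finset.Ico d k,
        (colorings k l 0).card * (colorings k r (c + 1)).card := by
      rw [colorings, Finset.card_biUnion]
      · refine Finset.sum_congr rfl fun c _ => ?_
        rw [Finset.card_image_of_injective, Finset.card_product]
        rintro ⟨a, b⟩ ⟨a', b'⟩ h
        simpa using h
      · intro c _ c' _ hne
        rw [Function.onFun, Finset.disjoint_left]
        intro S hS hS'
        simp only [Finset.mem_image] at hS hS'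
        obtain ⟨p, _, rfl⟩ := hS
        obtain ⟨p', _, h⟩ := hS'
        simp only [node.injEq] at h
        exact hne h.1.symm
    have h2 : ∑ c ∈ Finset.Ico d k, (colorings k l 0).card * (colorings k r (c + 1)).card =
        ∑ c ∈ Finset.Ico d k, (k - (c + 1)).choose (combAux r).1 *
          ((k.choose (combAux l).1 * ((combAux l).2.map (Nat.choose k)).prod) *
            ((combAux r).2.map (Nat.choose k)).prod) := by
      refine Finset.sum_congr rfl fun c hc => ?_
      have := Finset.mem_Ico.1 hc
      rw [ihl 0 (Nat.zero_le _), ihr (c + 1) (by omega), Nat.sub_zero]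
      ring
    rw [h1, h2, ← Finset.sum_mul, hockey k _ (k - d) d (by omega)]
    have h3 : (((if (combAux l).1 = 0 then 0 else {(combAux l).1}) : Multiset ℕ).map
        (Nat.choose k)).prod = k.choose (combAux l).1 := by
      split_ifs with h
      · simp [h]
      · simp
    simp only [combAux, Multiset.map_add, Multiset.prod_add, h3, add_comm 1]
    ring

theorem card_colorings_type (k : ℕ) (T : CTree) :
    (colorings k T 0).card = ((combType T).map (Nat.choose k)).prod := by
  rw [card_colorings k T 0 (Nat.zero_le _), combType, Multiset.map_add, Multiset.prod_add]
  congr 1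
  split_ifs with h
  · simp [h]
  · simp

/-- Lyndon trees with colors below `k` -/
def LynK (n k : ℕ) : Set CTree :=
  {T | OnSet n T ∧ Normalized T ∧ LynColored T ∧ ∀ c ∈ cols T, c < k}

/-- comb trees with colors below `k` -/
def CombK (n k : ℕ) : Set CTree :=
  {T | OnSet n T ∧ Normalized T ∧ CombC T ∧ ∀ c ∈ cols T, c < k}

theorem lynK_finite (n k : ℕ) : (LynK n k).Finite :=
  (finite_onSet n k).subset fun _ h => ⟨h.1, h.2.2.2⟩

theorem combK_finite (n k : ℕ) : (CombK n k).Finite :=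
  (finite_onSet n k).subset fun _ h => ⟨h.1, h.2.2.2⟩

theorem norSet_finite (n : ℕ) : (NorSet n).Finite :=
  (finite_onSet n 1).subset fun _ h => ⟨h.1, mono_cols h.2.2⟩

theorem bijOn_Th (n k : ℕ) : Set.BijOn Th (LynK n k) (CombK n k) := by
  refine ⟨?_, ?_, ?_⟩
  · rintro T ⟨h1, h2, h3, h4⟩
    obtain ⟨a1, a2, a3⟩ := Th_spec T h2
    obtain ⟨b1, b2, b3⟩ := Th_ms T
    refine ⟨?_, a1, a2, by rwa [b2]⟩
    rw [onSet_iff, b1]; exact onSet_iff.1 h1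
  · rintro T ⟨h1, h2, h3, h4⟩ T' ⟨h1', h2', h3', h4'⟩ h
    exact Th_inj _ T T' (le_refl _) h2 h3 (onSet_nodup h1) h2' h3' (onSet_nodup h1') h
  · rintro C ⟨h1, h2, h3, h4⟩
    obtain ⟨T, t1, t2, rfl⟩ := Th_surj _ C (le_refl _) h2 h3 (onSet_nodup h1)
    obtain ⟨b1, b2, b3⟩ := Th_ms T
    refine ⟨T, ⟨?_, t1, t2, by rwa [← b2]⟩, rfl⟩
    rw [onSet_iff, ← b1]; exact onSet_iff.1 h1

theorem combK_card (n k : ℕ) : (CombK n k).ncard =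
    ∑ᶠ T ∈ NorSet n, ((combType T).map (Nat.choose k)).prod := by
  rw [finsum_mem_eq_finite_toFinset_sum _ (norSet_finite n),
    Set.ncard_eq_toFinset_card _ (combK_finite n k),
    Finset.card_eq_sum_card_fiberwise (f := strip) (t := (norSet_finite n).toFinset)]
  · refine Finset.sum_congr rfl fun T hT => ?_
    rw [← card_colorings_type]
    congr 1
    ext S
    have hT : T ∈ NorSet n := by simpa using hT
    obtain ⟨t1, t2, t3⟩ := hT
    simp only [Finset.mem_filter, Set.Finite.mem_toFinset, mem_colorings, strip_mono t3]
    obtain ⟨s1, s2, s3, s4⟩ := strip_spec S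
    constructor
    · rintro ⟨⟨h1, h2, h3, h4⟩, h5⟩
      exact ⟨h5, h3, h4, Or.inr (Nat.zero_le _)⟩
    · rintro ⟨h5, h3, h4, -⟩
      rw [h5] at s1 s3
      refine ⟨⟨?_, s3.1 t2, h3, h4⟩, h5⟩
      rw [onSet_iff, ← s1]; exact onSet_iff.1 t1
  · intro S hS
    have hS : S ∈ CombK n k := by simpa using hS
    obtain ⟨h1, h2, h3, h4⟩ := hS
    obtain ⟨s1, s2, s3, s4⟩ := strip_spec S
    simp only [Set.Finite.coe_toFinset]
    refine ⟨?_, s3.2 h2, s4⟩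
    rw [onSet_iff, s1]; exact onSet_iff.1 h1

theorem lynK_card (n k : ℕ) : (LynK n k).ncard =
    ∑ f ∈ Finset.Nat.antidiagonalTuple k (n - 1), Nat.card (LynSetF n k f) := by
  rw [Set.ncard_eq_toFinset_card _ (lynK_finite n k),
    Finset.card_eq_sum_card_fiberwise (f := fun T => fun i : Fin k => colorCount T i)
      (t := Finset.Nat.antidiagonalTuple k (n - 1))]
  · refine Finset.sum_congr rfl fun f _ => ?_
    rw [Nat.card_coe_set_eq, ← Set.ncard_coe_finset]
    congr 1
    ext T
    simp only [Finset.coe_filter, Set.Finite.mem_toFinset, Set.mem_ofPred_eq, LynK, LynSetF]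
    constructor
    · rintro ⟨⟨h1, h2, h3, h4⟩, rfl⟩
      refine ⟨h1, h2, h3, fun j => ?_⟩
      split_ifs with hj
      · rfl
      · rw [colorCount_eq, Multiset.count_eq_zero]
        exact fun h => hj (h4 j h)
    · rintro ⟨h1, h2, h3, h4⟩
      refine ⟨⟨h1, h2, h3, fun c hc => ?_⟩, ?_⟩
      · by_contra hck
        have := h4 c
        rw [dif_neg hck, colorCount_eq, Multiset.count_eq_zero] at this
        exact this hc
      · funext i
        rw [h4 i, dif_pos i.2]
  · intro T hT
    have hT : T ∈ LynK n k := by simpa using hT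
    obtain ⟨h1, h2, h3, h4⟩ := hT
    simp only [Finset.mem_coe, Finset.Nat.mem_antidiagonalTuple]
    have hc := card_cols T
    rw [onSet_iff.1 h1] at hc
    simp only [Multiset.coe_card, List.length_map, List.length_range] at hc
    have : ∑ i ∈ Finset.range k, (cols T).count i = (cols T).card :=
      Multiset.sum_count_eq_card (fun c hc => Finset.mem_range.2 (h4 c hc))
    simp only [colorCount_eq]
    rw [Fin.sum_univ_eq_sum_range (fun i => (cols T).count i) k, this]
    omega

end CTree

/-- The total number of colored Lyndon trees on `[n]` with all colors in `[k]`,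
i.e. `Σ_{μ ∈ wcomp_{n-1}, supp(μ) ⊆ [k]} |Lyn_μ|` (this number is `dim Lie_k(n)`),
equals `Σ_{Υ ∈ Nor_n} e_{λ^{Comb}(Υ)}(1^k)`, where
`e_m(1^k) = (k choose m)`, so `e_λ(1^k) = Π_i (k choose λ_i)`. -/
theorem card_coloredLyndon_eq_combType_sum (n k : ℕ) (hn : 1 ≤ n) (hk : 1 ≤ k) :
    (∑ f ∈ Finset.Nat.antidiagonalTuple k (n - 1), Nat.card (LynSetF n k f)) =
      ∑ᶠ T ∈ NorSet n, ((CTree.combType T).map (Nat.choose k)).prod := by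
  rw [← CTree.lynK_card, ← CTree.combK_card]
  exact (CTree.bijOn_Th n k).ncard_eq
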